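/- Let 0 < β < 𝐍. There exists a constant C > 0, depending only on β, the root system R and the multiplicity function κ, such that for every x₀ ∈ ℝ^N, every R₀ > 0, every measurable g : ℝ^N → [0,∞], and every x ∈ ℝ^N with ‖x − x₀‖ ≤ R₀/5: ∫_{{ξ : d(ξ,x₀) ≥ R₀}} d(ξ,x₀)^{β−1} · ω(B(ξ, d(ξ,x₀)))^{−1} · g(ξ) dω(ξ) ≤ C · R₀^{−1} · Σ_{σ∈G} M^β g(σ(x)). -/

import Mathlib

open MeasureTheory Metric
open scoped ENNReal RealInnerProductSpace NNReal

noncomputable section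

variable {N : ℕ}

/-- The reflection `σ_α(x) = x - ⟨α,x⟩ α` associated with a normalized root `α`. -/
def dunklReflect (α x : EuclideanSpace ℝ (Fin N)) : EuclideanSpace ℝ (Fin N) :=
  x - ⟪α, x⟫ • α

/-- The reflection group `G` generated by the root reflections, realized as the subgroup of
linear isometries of `ℝ^N` whose generators act by the reflection formula. -/
def dunklGroup (Rs : Finset (EuclideanSpace ℝ (Fin N))) :
    Subgroup (EuclideanSpace ℝ (Fin N) ≃ₗᵢ[ℝ] EuclideanSpace ℝ (Fin N)) :=
  Subgroup.closure {σ | ∃ α ∈ Rs, ⇑σ = dunklReflect α}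

/-- The Dunkl weight `h_κ(x) = ∏_{α ∈ R} |⟨α,x⟩|^{κ(α)}`. -/
def dunklWeight (Rs : Finset (EuclideanSpace ℝ (Fin N))) (κ : EuclideanSpace ℝ (Fin N) → ℝ)
    (x : EuclideanSpace ℝ (Fin N)) : ℝ :=
  ∏ α ∈ Rs, |⟪α, x⟫| ^ κ α

/-- The Dunkl measure `dω(x) = h_κ(x) dx`. -/
def dunklMeasure (Rs : Finset (EuclideanSpace ℝ (Fin N)))
    (κ : EuclideanSpace ℝ (Fin N) → ℝ) : Measure (EuclideanSpace ℝ (Fin N)) :=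
  volume.withDensity fun x => ENNReal.ofReal (dunklWeight Rs κ x)

/-- The Dunkl metric `d(x,y) = min_{σ ∈ G} ‖x - σ(y)‖`. -/
def dunklDist (Rs : Finset (EuclideanSpace ℝ (Fin N))) (x y : EuclideanSpace ℝ (Fin N)) : ℝ :=
  ⨅ σ : dunklGroup Rs, ‖x - σ.1 y‖

/-- The Dunkl ball `O(B(x,r)) = {y : d(x,y) < r}`. -/
def dunklBall (Rs : Finset (EuclideanSpace ℝ (Fin N))) (x : EuclideanSpace ℝ (Fin N)) (r : ℝ) :
    Set (EuclideanSpace ℝ (Fin N)) :=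
  {y | dunklDist Rs x y < r}

/-- The fractional maximal function M^β g(x) = sup_{B ∋ x} ω(B)^{β/𝐍 - 1} ∫_B g dω. -/
def fracMaximal (μ : Measure (EuclideanSpace ℝ (Fin N))) (β bigN : ℝ)
    (g : EuclideanSpace ℝ (Fin N) → ℝ≥0∞) (x : EuclideanSpace ℝ (Fin N)) : ℝ≥0∞ :=
  ⨆ (z : EuclideanSpace ℝ (Fin N)) (r : ℝ) (_ : x ∈ ball z r),
    μ (ball z r) ^ (β / bigN - 1) * ∫⁻ y in ball z r, g y ∂μ

/-- Every ball contains a comparable ball which stays away from finitely many hyperplanes. -/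
theorem exists_ball_subset_le_abs_inner (Rs : Finset (EuclideanSpace ℝ (Fin N)))
    (hnorm : ∀ α ∈ Rs, ⟪α, α⟫ = (2 : ℝ)) :
    ∃ δ : ℝ, 0 < δ ∧ ∀ (x : EuclideanSpace ℝ (Fin N)) (r : ℝ), 0 < r →
      ∃ y, ball y (δ * r) ⊆ ball x r ∧ ∀ α ∈ Rs, ∀ z ∈ ball y (δ * r), δ * r ≤ |⟪α, z⟫| := by
  classical
  induction Rs using Finset.induction_on with
  | empty => exact ⟨1, one_pos, fun x r _ => ⟨x, by simp, by simp⟩⟩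
  | insert α s _ ih =>
    obtain ⟨δ, hδ, h⟩ := ih fun a ha => hnorm a (Finset.mem_insert_of_mem ha)
    have hα : ⟪α, α⟫ = (2 : ℝ) := hnorm α (Finset.mem_insert_self _ _)
    have hα_norm : ‖α‖ ≤ 2 := by
      rw [real_inner_self_eq_norm_sq] at hα
      nlinarith [norm_nonneg α]
    refine ⟨δ / 8, by positivity, fun x r hr => ?_⟩
    obtain ⟨y, hyx, hy⟩ := h x r hr
    have hδr : 0 < δ * r := mul_pos hδ hr
    obtain ⟨ε, hε, hεy⟩ : ∃ ε : ℝ, |ε| = 1 ∧ 0 ≤ ε * ⟪α, y⟫ := by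
      rcases le_total 0 ⟪α, y⟫ with h0 | h0
      · exact ⟨1, by simp, by simpa using h0⟩
      · exact ⟨-1, by simp, by simpa using h0⟩
    set t : ℝ := δ * r / 4 with ht
    have hsub : ball (y + (ε * t) • α) (δ / 8 * r) ⊆ ball y (δ * r) := by
      apply ball_subset_ball'
      rw [dist_eq_norm, add_sub_cancel_left, norm_smul, Real.norm_eq_abs, abs_mul, hε,
        abs_of_pos (by positivity : 0 < t)]
      nlinarith [mul_le_mul_of_nonneg_left hα_norm (by positivity : 0 ≤ t)]
    refine ⟨y + (ε * t) • α, hsub.trans hyx, fun a ha z hz => ?_⟩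
    rcases Finset.mem_insert.1 ha with rfl | ha
    · have hz' : |⟪a, z - (y + (ε * t) • a)⟫| ≤ 2 * (δ / 8 * r) := by
        refine (abs_real_inner_le_norm _ _).trans ?_
        rw [mem_ball, dist_eq_norm] at hz
        exact mul_le_mul hα_norm hz.le (norm_nonneg _) (by norm_num)
      rw [inner_sub_right, inner_add_right, inner_smul_right, hα] at hz'
      have hεε : ε * ε = 1 := by rw [← abs_mul_abs_self, hε, one_mul]
      have hle : ε * ⟪a, z⟫ ≤ |⟪a, z⟫| := by
        calc ε * ⟪a, z⟫ ≤ |ε * ⟪a, z⟫| := le_abs_self _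
          _ = |⟪a, z⟫| := by rw [abs_mul, hε, one_mul]
      have hlow : -(2 * (δ / 8 * r)) ≤ ε * (⟪a, z⟫ - (⟪a, y⟫ + ε * t * 2)) := by
        refine (neg_le_neg hz').trans ?_
        calc -|⟪a, z⟫ - (⟪a, y⟫ + ε * t * 2)|
            = -|ε * (⟪a, z⟫ - (⟪a, y⟫ + ε * t * 2))| := by rw [abs_mul ε, hε, one_mul]
          _ ≤ _ := neg_abs_le _
      have hexp : ε * (⟪a, z⟫ - (⟪a, y⟫ + ε * t * 2))
          = ε * ⟪a, z⟫ - ε * ⟪a, y⟫ - ε * ε * (t * 2) := by ring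
      rw [hexp, hεε] at hlow
      linarith
    · exact le_trans (by linarith) (hy a ha z (hsub hz))

theorem dunklWeight_le_of_abs_inner_le {Rs : Finset (EuclideanSpace ℝ (Fin N))}
    {κ : EuclideanSpace ℝ (Fin N) → ℝ} (hκ0 : ∀ α ∈ Rs, 0 ≤ κ α) {K : ℝ} (hK : 0 < K)
    {u z : EuclideanSpace ℝ (Fin N)} (h : ∀ α ∈ Rs, |⟪α, u⟫| ≤ K * |⟪α, z⟫|) :
    dunklWeight Rs κ u ≤ K ^ (∑ α ∈ Rs, κ α) * dunklWeight Rs κ z := by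
  unfold dunklWeight
  rw [Real.rpow_sum_of_pos hK, ← Finset.prod_mul_distrib]
  refine Finset.prod_le_prod (fun α _ => by positivity) fun α hα => ?_
  rw [← Real.mul_rpow hK.le (abs_nonneg _)]
  exact Real.rpow_le_rpow (abs_nonneg _) (h α hα) (hκ0 α hα)

theorem rpow_sum_le_dunklWeight {Rs : Finset (EuclideanSpace ℝ (Fin N))}
    {κ : EuclideanSpace ℝ (Fin N) → ℝ} (hκ0 : ∀ α ∈ Rs, 0 ≤ κ α) {t : ℝ} (ht : 0 < t)
    {z : EuclideanSpace ℝ (Fin N)} (h : ∀ α ∈ Rs, t ≤ |⟪α, z⟫|) :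
    t ^ (∑ α ∈ Rs, κ α) ≤ dunklWeight Rs κ z := by
  unfold dunklWeight
  rw [Real.rpow_sum_of_pos ht]
  exact Finset.prod_le_prod (fun α _ => by positivity) fun α hα =>
    Real.rpow_le_rpow ht.le (h α hα) (hκ0 α hα)

theorem dunklWeight_nonneg (Rs : Finset (EuclideanSpace ℝ (Fin N)))
    (κ : EuclideanSpace ℝ (Fin N) → ℝ) (x : EuclideanSpace ℝ (Fin N)) :
    0 ≤ dunklWeight Rs κ x :=
  Finset.prod_nonneg fun _ _ => by positivity

theorem le_dunklMeasure_ball {Rs : Finset (EuclideanSpace ℝ (Fin N))}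
    {κ : EuclideanSpace ℝ (Fin N) → ℝ} {x : EuclideanSpace ℝ (Fin N)} {r a : ℝ}
    (h : ∀ z ∈ ball x r, a ≤ dunklWeight Rs κ z) :
    ENNReal.ofReal a * volume (ball x r) ≤ dunklMeasure Rs κ (ball x r) := by
  rw [dunklMeasure, withDensity_apply _ measurableSet_ball, ← setLIntegral_const]
  exact setLIntegral_mono' measurableSet_ball fun z hz => ENNReal.ofReal_le_ofReal (h z hz)

theorem dunklMeasure_ball_le {Rs : Finset (EuclideanSpace ℝ (Fin N))}
    {κ : EuclideanSpace ℝ (Fin N) → ℝ} {x : EuclideanSpace ℝ (Fin N)} {r a : ℝ}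
    (h : ∀ z ∈ ball x r, dunklWeight Rs κ z ≤ a) :
    dunklMeasure Rs κ (ball x r) ≤ ENNReal.ofReal a * volume (ball x r) := by
  rw [dunklMeasure, withDensity_apply _ measurableSet_ball, ← setLIntegral_const]
  exact setLIntegral_mono' measurableSet_ball fun z hz => ENNReal.ofReal_le_ofReal (h z hz)

/-- The Dunkl measure is doubling. -/
theorem exists_dunklMeasure_ball_four_mul_le (Rs : Finset (EuclideanSpace ℝ (Fin N)))
    (κ : EuclideanSpace ℝ (Fin N) → ℝ) (hnorm : ∀ α ∈ Rs, ⟪α, α⟫ = (2 : ℝ))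
    (hκ0 : ∀ α ∈ Rs, 0 ≤ κ α) :
    ∃ D : ℝ, 0 < D ∧ ∀ (x : EuclideanSpace ℝ (Fin N)) (r : ℝ), 0 < r →
      dunklMeasure Rs κ (ball x (4 * r)) ≤ ENNReal.ofReal D * dunklMeasure Rs κ (ball x r) := by
  obtain ⟨δ, hδ, h⟩ := exists_ball_subset_le_abs_inner Rs hnorm
  set K : ℝ := 1 + 10 / δ with hK
  have hK0 : 0 < K := by positivity
  set Γ : ℝ := K ^ (∑ α ∈ Rs, κ α) with hΓ
  have hΓ0 : 0 < Γ := Real.rpow_pos_of_pos hK0 _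
  refine ⟨Γ * Γ * (4 / δ) ^ N, by positivity, fun x r hr => ?_⟩
  obtain ⟨y, hyx, hy⟩ := h x r hr
  have hδr : 0 < δ * r := mul_pos hδ hr
  have hcomp : ∀ u ∈ ball x (4 * r), ∀ z ∈ ball y (δ * r),
      dunklWeight Rs κ u ≤ Γ * dunklWeight Rs κ z := by
    refine fun u hu z hz => dunklWeight_le_of_abs_inner_le hκ0 hK0 fun α hα => ?_
    have hα_norm : ‖α‖ ≤ 2 := by
      have := hnorm α hα
      rw [real_inner_self_eq_norm_sq] at this
      nlinarith [norm_nonneg α]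
    have huz : ‖u - z‖ ≤ 5 * r := by
      have h1 := mem_ball.1 hu
      have h2 := mem_ball.1 (hyx hz)
      rw [← dist_eq_norm]
      linarith [dist_triangle_right u z x]
    have hdiff : |⟪α, u - z⟫| ≤ 2 * (5 * r) :=
      (abs_real_inner_le_norm _ _).trans (mul_le_mul hα_norm huz (norm_nonneg _) (by norm_num))
    have hlow := hy α hα z hz
    have hscale : 10 * r ≤ 10 / δ * |⟪α, z⟫| := by
      calc 10 * r = 10 / δ * (δ * r) := by field_simp
        _ ≤ _ := by gcongr
    have habs : |⟪α, u⟫| ≤ |⟪α, z⟫| + |⟪α, u - z⟫| := by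
      rw [inner_sub_right]
      simpa using abs_add_le ⟪α, z⟫ (⟪α, u⟫ - ⟪α, z⟫)
    rw [hK]
    linarith
  have hy4 : y ∈ ball x (4 * r) :=
    ball_subset_ball (by linarith) (hyx (mem_ball_self hδr))
  have hlow : ENNReal.ofReal (dunklWeight Rs κ y / Γ) * volume (ball y (δ * r))
      ≤ dunklMeasure Rs κ (ball x r) :=
    (le_dunklMeasure_ball fun z hz => by
      rw [div_le_iff₀' hΓ0]; exact hcomp y hy4 z hz).trans (measure_mono hyx)
  have hup : dunklMeasure Rs κ (ball x (4 * r))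
      ≤ ENNReal.ofReal (Γ * dunklWeight Rs κ y) * volume (ball x (4 * r)) :=
    dunklMeasure_ball_le fun u hu => hcomp u hu y (mem_ball_self hδr)
  refine hup.trans (le_trans (le_of_eq ?_) (mul_le_mul_right hlow _))
  have hw := dunklWeight_nonneg Rs κ y
  rw [Measure.addHaar_ball_of_pos _ _ (by positivity : 0 < 4 * r),
    Measure.addHaar_ball_of_pos _ _ hδr, finrank_euclideanSpace_fin, ← mul_assoc, ← mul_assoc,
    ← mul_assoc, ← ENNReal.ofReal_mul (by positivity), ← ENNReal.ofReal_mul (by positivity),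
    ← ENNReal.ofReal_mul (by positivity)]
  congr 2
  rw [mul_pow, mul_pow, div_pow]
  field_simp

/-- The Dunkl measure of a ball of radius `r` is at least a multiple of `r ^ 𝐍`. -/
theorem exists_le_dunklMeasure_ball (Rs : Finset (EuclideanSpace ℝ (Fin N)))
    (κ : EuclideanSpace ℝ (Fin N) → ℝ) (hnorm : ∀ α ∈ Rs, ⟪α, α⟫ = (2 : ℝ))
    (hκ0 : ∀ α ∈ Rs, 0 ≤ κ α) :
    ∃ c : ℝ, 0 < c ∧ ∀ (x : EuclideanSpace ℝ (Fin N)) (r : ℝ), 0 < r →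
      ENNReal.ofReal (c * r ^ ((N : ℝ) + ∑ α ∈ Rs, κ α)) ≤ dunklMeasure Rs κ (ball x r) := by
  obtain ⟨δ, hδ, h⟩ := exists_ball_subset_le_abs_inner Rs hnorm
  set v : ℝ := (volume (ball (0 : EuclideanSpace ℝ (Fin N)) 1)).toReal with hv
  have hv0 : 0 < v :=
    ENNReal.toReal_pos (measure_ball_pos _ _ one_pos).ne' measure_ball_lt_top.ne
  refine ⟨δ ^ ((N : ℝ) + ∑ α ∈ Rs, κ α) * v, by positivity, fun x r hr => ?_⟩
  obtain ⟨y, hyx, hy⟩ := h x r hr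
  have hδr : 0 < δ * r := mul_pos hδ hr
  refine le_trans (le_of_eq ?_) ((le_dunklMeasure_ball fun z hz =>
    rpow_sum_le_dunklWeight hκ0 hδr fun α hα => hy α hα z hz).trans (measure_mono hyx))
  rw [Measure.addHaar_ball_of_pos _ _ hδr, finrank_euclideanSpace_fin,
    ← ENNReal.ofReal_toReal (measure_ball_lt_top
      (μ := volume) (x := (0 : EuclideanSpace ℝ (Fin N))) (r := 1)).ne, ← hv,
    ← ENNReal.ofReal_mul (by positivity), ← ENNReal.ofReal_mul (by positivity)]
  congr 1
  rw [← Real.rpow_natCast (δ * r) N, mul_right_comm, ← Real.mul_rpow hδ.le hr.le,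
    Real.rpow_add hδr]
  ring

theorem exists_dunklDist_eq (Rs : Finset (EuclideanSpace ℝ (Fin N)))
    [Finite (dunklGroup Rs)] (x y : EuclideanSpace ℝ (Fin N)) :
    ∃ σ : dunklGroup Rs, dunklDist Rs x y = ‖x - σ.1 y‖ := by
  obtain ⟨σ, hσ⟩ := exists_eq_ciInf_of_finite (f := fun σ : dunklGroup Rs => ‖x - σ.1 y‖)
  exact ⟨σ, hσ.symm⟩

/-- Averages over balls of radius `s` are controlled by `s ^ (-β)` times the fractional maximal
function, when the measure of such balls is at least a multiple of `s ^ 𝐍`. -/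
theorem inv_mul_setLIntegral_ball_le_fracMaximal
    {μ : Measure (EuclideanSpace ℝ (Fin N))} {β bigN c s : ℝ} (hβ : 0 < β) (hbigN : 0 < bigN)
    (hc : 0 < c) (hs : 0 < s) {x z : EuclideanSpace ℝ (Fin N)} (hx : x ∈ ball z s)
    (hμ : ENNReal.ofReal (c * s ^ bigN) ≤ μ (ball z s)) (g : EuclideanSpace ℝ (Fin N) → ℝ≥0∞) :
    (μ (ball z s))⁻¹ * ∫⁻ y in ball z s, g y ∂μ
      ≤ ENNReal.ofReal (c ^ (-(β / bigN)) * s ^ (-β)) * fracMaximal μ β bigN g x := by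
  rcases eq_or_ne (μ (ball z s)) ⊤ with htop | htop
  · simp [htop]
  have hcs : 0 < c * s ^ bigN := by positivity
  have hne : μ (ball z s) ≠ 0 := ((ENNReal.ofReal_pos.2 hcs).trans_le hμ).ne'
  have hinv : (μ (ball z s))⁻¹
      = μ (ball z s) ^ (-(β / bigN)) * μ (ball z s) ^ (β / bigN - 1) := by
    rw [← ENNReal.rpow_add _ _ hne htop, ← ENNReal.rpow_neg_one]
    congr 1
    ring
  have hpow : μ (ball z s) ^ (-(β / bigN)) ≤ ENNReal.ofReal (c ^ (-(β / bigN)) * s ^ (-β)) := by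
    have hreal : c ^ (-(β / bigN)) * s ^ (-β) = (c * s ^ bigN) ^ (-(β / bigN)) := by
      rw [Real.mul_rpow hc.le (by positivity), ← Real.rpow_mul hs.le]
      congr 2
      field_simp
    rw [hreal, ← ENNReal.ofReal_rpow_of_pos hcs, ENNReal.rpow_neg, ENNReal.rpow_neg,
      ENNReal.inv_le_inv]
    exact ENNReal.rpow_le_rpow hμ (by positivity)
  rw [hinv, mul_assoc]
  refine mul_le_mul' hpow ?_
  exact le_iSup_of_le z (le_iSup_of_le s (le_iSup_of_le hx le_rfl))


/-- Tail integral bounded by the fractional maximal function on the orbit of x. -/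
theorem dunkl_tail_integral_le_fracMaximal
    (Rs : Finset (EuclideanSpace ℝ (Fin N))) (κ : EuclideanSpace ℝ (Fin N) → ℝ)
    (hN : 1 ≤ N)
    (hnorm : ∀ α ∈ Rs, ⟪α, α⟫ = (2 : ℝ))
    (hRinv : ∀ α ∈ Rs, ∀ β ∈ Rs, dunklReflect α β ∈ Rs)
    (hκ0 : ∀ α ∈ Rs, 0 ≤ κ α)
    (hκinv : ∀ α ∈ Rs, ∀ β ∈ Rs, κ (dunklReflect α β) = κ β)
    (hGfin : Finite (dunklGroup Rs))
    (bigN : ℝ) (hbigN : bigN = (N : ℝ) + ∑ α ∈ Rs, κ α)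
    (β : ℝ) (hβ0 : 0 < β) (hβ : β < bigN) :
    ∃ C : ℝ, 0 < C ∧ ∀ (x₀ : EuclideanSpace ℝ (Fin N)) (R₀ : ℝ), 0 < R₀ →
      ∀ g : EuclideanSpace ℝ (Fin N) → ℝ≥0∞, Measurable g →
      ∀ x : EuclideanSpace ℝ (Fin N), ‖x - x₀‖ ≤ R₀ / 5 →
      ∫⁻ ξ in {ξ | R₀ ≤ dunklDist Rs ξ x₀},
          ENNReal.ofReal (dunklDist Rs ξ x₀ ^ (β - 1)) *
            (dunklMeasure Rs κ (ball ξ (dunklDist Rs ξ x₀)))⁻¹ * g ξ ∂(dunklMeasure Rs κ)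
        ≤ ENNReal.ofReal (C / R₀) *
            ∑' σ : dunklGroup Rs, fracMaximal (dunklMeasure Rs κ) β bigN g (σ.1 x) := by
  obtain ⟨D, hD, hdouble⟩ := exists_dunklMeasure_ball_four_mul_le Rs κ hnorm hκ0
  obtain ⟨c, hc, hlow⟩ := exists_le_dunklMeasure_ball Rs κ hnorm hκ0
  rw [← hbigN] at hlow
  have hbigN0 : 0 < bigN := hβ0.trans hβ
  set μ := dunklMeasure Rs κ with hμ
  set A : ℝ := D * c ^ (-(β / bigN)) with hA
  have hA0 : 0 < A := by positivity
  refine ⟨A * 2, by positivity, fun x₀ R₀ hR₀ g hg x hx => ?_⟩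
  set F : EuclideanSpace ℝ (Fin N) → ℝ≥0∞ := fun ξ =>
    ENNReal.ofReal (dunklDist Rs ξ x₀ ^ (β - 1)) * (μ (ball ξ (dunklDist Rs ξ x₀)))⁻¹ * g ξ
    with hF
  set S : ℕ × dunklGroup Rs → Set (EuclideanSpace ℝ (Fin N)) := fun p =>
    {ξ | 2 ^ p.1 * R₀ ≤ dunklDist Rs ξ x₀ ∧ dunklDist Rs ξ x₀ < 2 * (2 ^ p.1 * R₀) ∧
      ξ ∈ ball (p.2.1 x₀) (2 * (2 ^ p.1 * R₀))} with hS
  have hcover : {ξ | R₀ ≤ dunklDist Rs ξ x₀} ⊆ ⋃ p, S p := by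
    intro ξ hξ
    obtain ⟨k, hk1, hk2⟩ := exists_nat_pow_near ((one_le_div hR₀).2 hξ) one_lt_two
    rw [le_div_iff₀ hR₀] at hk1
    rw [div_lt_iff₀ hR₀, pow_succ'] at hk2
    obtain ⟨σ, hσ⟩ := exists_dunklDist_eq Rs ξ x₀
    refine Set.mem_iUnion.2 ⟨(k, σ), hk1, by linarith, ?_⟩
    rw [mem_ball, dist_eq_norm, ← hσ]
    linarith
  have hpiece : ∀ p, ∫⁻ ξ in S p, F ξ ∂μ
      ≤ ENNReal.ofReal (A / R₀ * (1 / 2) ^ p.1) * fracMaximal μ β bigN g (p.2.1 x) := by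
    rintro ⟨k, σ⟩
    set t : ℝ := 2 ^ k * R₀ with ht
    have ht0 : 0 < t := by positivity
    have hR₀t : R₀ ≤ t := le_mul_of_one_le_left hR₀.le (one_le_pow₀ one_le_two)
    have hσx : σ.1 x ∈ ball (σ.1 x₀) (2 * t) := by
      rw [mem_ball, LinearIsometryEquiv.dist_map, dist_eq_norm]
      linarith
    have hbound : ∀ ξ ∈ S (k, σ), F ξ
        ≤ ENNReal.ofReal ((2 * t) ^ β / t * D) * (μ (ball (σ.1 x₀) (2 * t)))⁻¹ * g ξ := by
      rintro ξ ⟨h1, h2, h3⟩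
      change t ≤ _ at h1
      change _ < 2 * t at h2
      change ξ ∈ ball (σ.1 x₀) (2 * t) at h3
      have hd : 0 < dunklDist Rs ξ x₀ := ht0.trans_le h1
      have hpow : dunklDist Rs ξ x₀ ^ (β - 1) ≤ (2 * t) ^ β / t := by
        rw [Real.rpow_sub_one hd.ne']
        gcongr
      have hball : μ (ball (σ.1 x₀) (2 * t)) ≤
          ENNReal.ofReal D * μ (ball ξ (dunklDist Rs ξ x₀)) := by
        refine (measure_mono (ball_subset_ball' ?_)).trans (hdouble ξ _ hd)
        rw [mem_ball'] at h3
        linarith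
      have hinv : (μ (ball ξ (dunklDist Rs ξ x₀)))⁻¹
          ≤ ENNReal.ofReal D * (μ (ball (σ.1 x₀) (2 * t)))⁻¹ := by
        have hD' : ENNReal.ofReal D ≠ 0 := (ENNReal.ofReal_pos.2 hD).ne'
        rw [← ENNReal.inv_le_inv, ENNReal.mul_inv (.inl hD') (.inl ENNReal.ofReal_ne_top)] at hball
        calc (μ (ball ξ (dunklDist Rs ξ x₀)))⁻¹
            = ENNReal.ofReal D * ((ENNReal.ofReal D)⁻¹ *
                (μ (ball ξ (dunklDist Rs ξ x₀)))⁻¹) := by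
              rw [← mul_assoc, ENNReal.mul_inv_cancel hD' ENNReal.ofReal_ne_top, one_mul]
          _ ≤ _ := by gcongr
      rw [ENNReal.ofReal_mul (by positivity), mul_assoc (ENNReal.ofReal _) (ENNReal.ofReal D)]
      exact mul_le_mul' (mul_le_mul' (ENNReal.ofReal_le_ofReal hpow) hinv) le_rfl
    calc ∫⁻ ξ in S (k, σ), F ξ ∂μ
        ≤ ∫⁻ ξ in S (k, σ), ENNReal.ofReal ((2 * t) ^ β / t * D) *
            (μ (ball (σ.1 x₀) (2 * t)))⁻¹ * g ξ ∂μ :=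
          setLIntegral_mono (by fun_prop) hbound
      _ ≤ ∫⁻ ξ in ball (σ.1 x₀) (2 * t), ENNReal.ofReal ((2 * t) ^ β / t * D) *
            (μ (ball (σ.1 x₀) (2 * t)))⁻¹ * g ξ ∂μ :=
          lintegral_mono_set fun ξ hξ => hξ.2.2
      _ = ENNReal.ofReal ((2 * t) ^ β / t * D) * ((μ (ball (σ.1 x₀) (2 * t)))⁻¹ *
            ∫⁻ ξ in ball (σ.1 x₀) (2 * t), g ξ ∂μ) := by
          rw [lintegral_const_mul _ hg, mul_assoc]
      _ ≤ ENNReal.ofReal ((2 * t) ^ β / t * D) *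
            (ENNReal.ofReal (c ^ (-(β / bigN)) * (2 * t) ^ (-β)) *
              fracMaximal μ β bigN g (σ.1 x)) := by
          exact mul_le_mul_right (inv_mul_setLIntegral_ball_le_fracMaximal hβ0 hbigN0 hc
            (by positivity) hσx (hlow _ _ (by positivity)) g) _
      _ = _ := by
          rw [← mul_assoc, ← ENNReal.ofReal_mul (by positivity)]
          congr 2
          rw [Real.rpow_neg (by positivity : 0 ≤ 2 * t), hA, ht, one_div, inv_pow]
          field_simp
  calc ∫⁻ ξ in {ξ | R₀ ≤ dunklDist Rs ξ x₀}, F ξ ∂μ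
      ≤ ∫⁻ ξ in ⋃ p, S p, F ξ ∂μ := lintegral_mono_set hcover
    _ ≤ ∑' p, ∫⁻ ξ in S p, F ξ ∂μ := lintegral_iUnion_le _ _
    _ ≤ ∑' p : ℕ × dunklGroup Rs,
          ENNReal.ofReal (A / R₀ * (1 / 2) ^ p.1) * fracMaximal μ β bigN g (p.2.1 x) :=
        ENNReal.tsum_le_tsum hpiece
    _ = (∑' k : ℕ, ENNReal.ofReal (A / R₀ * (1 / 2) ^ k)) *
          ∑' σ : dunklGroup Rs, fracMaximal μ β bigN g (σ.1 x) := by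
        rw [ENNReal.tsum_prod', ← ENNReal.tsum_mul_right]
        simp_rw [ENNReal.tsum_mul_left]
    _ = _ := by
        rw [← ENNReal.ofReal_tsum_of_nonneg (fun k => by positivity)
          (summable_geometric_two.mul_left _), tsum_mul_left, tsum_geometric_two, div_mul_eq_mul_div]
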